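/- Let S be a numerical semigroup and let n ∈ S with n ≥ 2. Then there exists a numerical semigroup T whose smallest nonzero element equals n such that T and S have the same Kunz poset with respect to n: for all distinct i, j ∈ {1, …, n−1}, there exists s ∈ S with a_i(S;n) + s = a_j(S;n) if and only if there exists t ∈ T with a_i(T;n) + t = a_j(T;n). -/

import Mathlib

/-- A numerical semigroup: an additive submonoid of `ℕ` with finite complement. -/
def IsNumericalSemigroup (S : Set ℕ) : Prop :=
  0 ∈ S ∧ (∀ a ∈ S, ∀ b ∈ S, a + b ∈ S) ∧ (Sᶜ : Set ℕ).Finite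

/-- `aElt S n i` is the smallest element of `S` congruent to `i` modulo `n`. -/
noncomputable def aElt (S : Set ℕ) (n i : ℕ) : ℕ :=
  sInf {s | s ∈ S ∧ s % n = i % n}


lemma aElt_congr (S : Set ℕ) (n i j : ℕ) (h : i % n = j % n) : aElt S n i = aElt S n j := by
  unfold aElt; rw [h]

lemma aElt_le (S : Set ℕ) (n i s : ℕ) (hs : s ∈ S) (h : s % n = i % n) : aElt S n i ≤ s :=
  Nat.sInf_le ⟨hs, h⟩

lemma aElt_spec (S : Set ℕ) (hS : IsNumericalSemigroup S) (n : ℕ) (hn : 2 ≤ n) (i : ℕ) :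
    aElt S n i ∈ S ∧ aElt S n i % n = i % n := by
  have hne : {s | s ∈ S ∧ s % n = i % n}.Nonempty := by
    obtain ⟨B, hB⟩ := hS.2.2.bddAbove
    refine ⟨i + n * (B + 1), ?_, by simp⟩
    by_contra hc
    have h1 := hB hc
    nlinarith
  exact Nat.sInf_mem hne

lemma mem_mul (S : Set ℕ) (hS : IsNumericalSemigroup S) (n : ℕ) (hnS : n ∈ S) (a : ℕ)
    (ha : a ∈ S) (k : ℕ) : a + n * k ∈ S := by
  induction k with
  | zero => simpa using ha
  | succ k ih =>
    have := hS.2.1 _ ih _ hnS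
    rwa [Nat.mul_succ, ← Nat.add_assoc]

lemma mem_iff_aElt (S : Set ℕ) (hS : IsNumericalSemigroup S) (n : ℕ) (hn : 2 ≤ n) (hnS : n ∈ S)
    (s : ℕ) : s ∈ S ↔ aElt S n s ≤ s := by
  refine ⟨fun h => aElt_le S n s s h rfl, fun h => ?_⟩
  obtain ⟨h1, h2⟩ := aElt_spec S hS n hn s
  obtain ⟨k, hk⟩ := (Nat.modEq_iff_dvd' h).1 h2
  have := mem_mul S hS n hnS _ h1 k
  rwa [← hk, Nat.add_sub_cancel' h] at this

lemma scale_mod (n s : ℕ) : ((n + 1) * s) % n = s % n := by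
  rw [Nat.add_mul, Nat.one_mul, Nat.add_comm, Nat.add_mul_mod_self_left]

/-- For any numerical semigroup `S` and `n ∈ S` with `n ≥ 2`, there is a
numerical semigroup `T` with multiplicity (smallest nonzero element) `n`
having the same Kunz poset with respect to `n` as `S`. -/
theorem stmt17 (S : Set ℕ) (hS : IsNumericalSemigroup S)
    (n : ℕ) (hn : 2 ≤ n) (hnS : n ∈ S) :
    ∃ T : Set ℕ, IsNumericalSemigroup T ∧ IsLeast {t ∈ T | t ≠ 0} n ∧
      ∀ i j : ℕ, 1 ≤ i → i ≤ n - 1 → 1 ≤ j → j ≤ n - 1 → i ≠ j →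
        ((∃ s ∈ S, aElt S n i + s = aElt S n j) ↔
          (∃ t ∈ T, aElt T n i + t = aElt T n j)) := by
  have hspec := aElt_spec S hS n hn
  have hmem := mem_iff_aElt S hS n hn hnS
  have hT : IsNumericalSemigroup {t | (n + 1) * aElt S n t ≤ t} := by
    refine ⟨?_, ?_, ?_⟩
    · have : aElt S n 0 ≤ 0 := aElt_le S n 0 0 hS.1 rfl
      simp only [Set.mem_setOf_eq]
      nlinarith
    · intro a ha b hb
      simp only [Set.mem_setOf_eq] at *
      have : aElt S n (a + b) ≤ aElt S n a + aElt S n b :=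
        aElt_le _ _ _ _ (hS.2.1 _ (hspec a).1 _ (hspec b).1)
          (Nat.ModEq.add (hspec a).2 (hspec b).2)
      nlinarith
    · apply (Set.finite_Iio ((n + 1) * ∑ i ∈ Finset.range n, aElt S n i)).subset
      intro t ht
      simp only [Set.mem_compl_iff, Set.mem_setOf_eq, not_le] at ht
      refine lt_of_lt_of_le ht (Nat.mul_le_mul_left _ ?_)
      rw [aElt_congr S n t (t % n) (by simp)]
      exact Finset.single_le_sum (f := fun i => aElt S n i) (fun _ _ => Nat.zero_le _)
        (Finset.mem_range.2 (Nat.mod_lt _ (by omega)))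
  have hTa : ∀ i, aElt {t | (n + 1) * aElt S n t ≤ t} n i = (n + 1) * aElt S n i := by
    intro i
    apply le_antisymm
    · apply aElt_le
      · simp only [Set.mem_setOf_eq]
        rw [aElt_congr S n ((n + 1) * aElt S n i) i (by rw [scale_mod]; exact (hspec i).2)]
      · rw [scale_mod]; exact (hspec i).2
    · obtain ⟨h1, h2⟩ := aElt_spec _ hT n hn i
      simp only [Set.mem_setOf_eq] at h1
      rwa [aElt_congr S n _ i h2] at h1
  refine ⟨{t | (n + 1) * aElt S n t ≤ t}, hT, ⟨⟨?_, by omega⟩, ?_⟩, ?_⟩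
  · have : aElt S n n ≤ 0 := aElt_le S n n 0 hS.1 (by simp)
    simp only [Set.mem_setOf_eq]
    nlinarith
  · rintro t ⟨ht, h0⟩
    simp only [Set.mem_setOf_eq] at ht
    rcases Nat.eq_zero_or_pos (aElt S n t) with h | h
    · have h2 := (hspec t).2
      rw [h, Nat.zero_mod] at h2
      exact Nat.le_of_dvd (by omega) (Nat.dvd_of_mod_eq_zero h2.symm)
    · nlinarith
  · intro i j _ _ _ _ _
    have key : ∀ s, (n + 1) * s ∈ {t | (n + 1) * aElt S n t ≤ t} ↔ s ∈ S := by
      intro s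
      rw [hmem s, Set.mem_setOf_eq, aElt_congr S n _ s (scale_mod n s)]
      exact Nat.mul_le_mul_left_iff (by omega)
    rw [hTa, hTa]
    constructor
    · rintro ⟨s, hs, h⟩
      exact ⟨(n + 1) * s, (key s).2 hs, by rw [← h]; ring⟩
    · rintro ⟨t, ht, h⟩
      have hd : (n + 1) ∣ t := (Nat.dvd_add_right (Dvd.intro _ rfl)).1 (h ▸ Dvd.intro _ rfl)
      obtain ⟨s, rfl⟩ := hd
      refine ⟨s, (key s).1 ht, ?_⟩
      rw [← Nat.mul_add] at h
      exact Nat.eq_of_mul_eq_mul_left (by omega) h
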